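/- Fix k ≥ 2. For every type t in 𝒯_k^• = 𝒯_k \ 𝒯_k^★, the generating series C_t(z) has radius of convergence strictly larger than 1/4. Consequently, there exists κ_t < 4 such that [z^n] C_t(z) = O(κ_t^n). -/

import Mathlib

open FirstOrder Filter Asymptotics Topology

namespace Av231

/-- Relation symbols of the theory of two orders: two binary relations `<_P` and `<_V`. -/
inductive TwoRel : ℕ → Type
  | lp : TwoRel 2
  | lv : TwoRel 2

/-- The first-order language with two binary relation symbols `<_P` and `<_V`. -/
def L : Language := ⟨fun _ => Empty, TwoRel⟩

/-- The `L`-structure on `Fin n` associated with a permutation `σ` of `{1,…,n}`: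
`i <_P j` iff `i < j` and `i <_V j` iff `σ i < σ j`. -/
def pStruct {n : ℕ} (σ : Equiv.Perm (Fin n)) : L.Structure (Fin n) where
  funMap := fun f _ => nomatch f
  RelMap := fun r x =>
    match r with
    | .lp => x 0 < x 1
    | .lv => σ (x 0) < σ (x 1)

/-- A permutation satisfies a first-order sentence. -/
def Sat {n : ℕ} (σ : Equiv.Perm (Fin n)) (ψ : L.Sentence) : Prop :=
  @Language.Sentence.Realize L (Fin n) (pStruct σ) ψ

/-- The quantifier depth of a first-order formula. -/
def qd {L' : Language} {α : Type*} : ∀ {n : ℕ}, L'.BoundedFormula α n → ℕ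
  | _, .falsum => 0
  | _, .equal _ _ => 0
  | _, .rel _ _ => 0
  | _, .imp f g => max (qd f) (qd g)
  | _, .all f => qd f + 1

/-- A permutation avoids the pattern `231`. -/
def Avoids {n : ℕ} (σ : Equiv.Perm (Fin n)) : Prop :=
  ¬ ∃ i j k : Fin n, i < j ∧ j < k ∧ σ k < σ i ∧ σ i < σ j

/-- The number of `231`-avoiding permutations of size `n` satisfying `ψ`. -/
noncomputable def avN (n : ℕ) (ψ : L.Sentence) : ℕ :=
  Nat.card {σ : Equiv.Perm (Fin n) // Avoids σ ∧ Sat σ ψ}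

/-- The probability that a uniform random `231`-avoiding permutation of size `n`
satisfies `ψ` (the number of `231`-avoiding permutations of size `n` is `catalan n`). -/
noncomputable def prob (n : ℕ) (ψ : L.Sentence) : ℝ :=
  (avN n ψ : ℝ) / (catalan n : ℝ)

/-- Permutations of arbitrary finite size. -/
abbrev FinPerm := Σ n : ℕ, Equiv.Perm (Fin n)

def AvoidsF (p : FinPerm) : Prop := Avoids p.2

/-- Direct sum of permutations. -/
def dsum {a b : ℕ} (σ : Equiv.Perm (Fin a)) (τ : Equiv.Perm (Fin b)) :
    Equiv.Perm (Fin (a + b)) :=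
  finSumFinEquiv.permCongr (Equiv.sumCongr σ τ)

/-- Skew sum of permutations. -/
def ssum {a b : ℕ} (σ : Equiv.Perm (Fin a)) (τ : Equiv.Perm (Fin b)) :
    Equiv.Perm (Fin (a + b)) :=
  finSumFinEquiv.symm.trans ((Equiv.sumCongr σ τ).trans
    ((Equiv.sumComm (Fin a) (Fin b)).trans (finSumFinEquiv.trans (finCongr (Nat.add_comm b a)))))

/-- The operation `(τ, π) ↦ τ ⊕ (1 ⊖ π)` on permutations of arbitrary sizes. -/
def glue (τ π : FinPerm) : FinPerm :=
  ⟨τ.1 + (1 + π.1), dsum τ.2 (ssum (1 : Equiv.Perm (Fin 1)) π.2)⟩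

/-- Two permutations are `k`-equivalent when they satisfy the same first-order sentences
of quantifier depth at most `k`. -/
def kEquiv (k : ℕ) (p q : FinPerm) : Prop :=
  ∀ ψ : L.Sentence, qd ψ ≤ k → (Sat p.2 ψ ↔ Sat q.2 ψ)

end Av231

/-- `k`-equivalence as a setoid on finite permutations. -/
def kSetoid (k : ℕ) : Setoid Av231.FinPerm :=
  ⟨Av231.kEquiv k,
    ⟨fun _ _ _ => Iff.rfl, fun h ψ hψ => (h ψ hψ).symm,
      fun h h' ψ hψ => (h ψ hψ).trans (h' ψ hψ)⟩⟩

namespace Av231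

/-- Logical types of order `k`: equivalence classes of `≡ₖ`. -/
def QT (k : ℕ) := Quotient (kSetoid k)

/-- The logical type of order `k` of a permutation. -/
def typeOf (k : ℕ) (p : FinPerm) : QT k := Quotient.mk (kSetoid k) p

/-- A type is realized when some `231`-avoiding permutation has this type;
`𝒯ₖ` consists of the realized types. -/
def Realized (k : ℕ) (t : QT k) : Prop := ∃ p : FinPerm, AvoidsF p ∧ typeOf k p = t

/-- The number of `231`-avoiding permutations of size `n` whose logical type of order `k`
is `t`, i.e. the `n`-th coefficient of the generating series `C_t`. -/
noncomputable def cnt (k : ℕ) (t : QT k) (n : ℕ) : ℕ :=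
  Nat.card {σ : Equiv.Perm (Fin n) // Avoids σ ∧ typeOf k ⟨n, σ⟩ = t}

/-- The type of the empty permutation. -/
def emptyType (k : ℕ) : QT k := typeOf k ⟨0, 1⟩

/-- `H_k(t₁,t₂)`: the type of `τ ⊕ (1 ⊖ π)` where `τ, π` are representatives
of `t₁, t₂` respectively. -/
noncomputable def Hfun (k : ℕ) (t₁ t₂ : QT k) : QT k :=
  typeOf k (glue (Quotient.out t₁) (Quotient.out t₂))

/-- The edge relation `u → t` of the dependency graph `G_k`:
`∂F_t/∂C_u ≠ 0`, i.e. some `v ∈ 𝒯ₖ` satisfies `H_k(u,v) = t` or `H_k(v,u) = t`. -/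
def Edge (k : ℕ) (u t : QT k) : Prop :=
  ∃ v : QT k, Realized k v ∧ (Hfun k u v = t ∨ Hfun k v u = t)

/-- The set `𝒯ₖ` of types realized by `231`-avoiding permutations, as a type. -/
def Tk (k : ℕ) := {t : QT k // Realized k t}

/-- The edge relation of `G_k` restricted to `𝒯ₖ`. -/
def EdgeT (k : ℕ) (u t : Tk k) : Prop := Edge k u.1 t.1

/-- `S` is a terminal strongly connected component of the dependency graph `G_k`:
it is nonempty, any vertex of `S` reaches any other, and no edge leaves `S`
(this forces maximality, hence being an SCC). -/
def IsTermSCC (k : ℕ) (S : Set (Tk k)) : Prop :=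
  S.Nonempty ∧ (∀ u ∈ S, ∀ v ∈ S, Relation.ReflTransGen (EdgeT k) u v) ∧
    (∀ u ∈ S, ∀ v : Tk k, EdgeT k u v → v ∈ S)

/-- A sequence of coefficients is periodic when, for some `d ≥ 2` and `r`,
it vanishes outside `dℤ + r`. -/
def SeqPeriodic (a : ℕ → ℝ) : Prop :=
  ∃ d : ℕ, 2 ≤ d ∧ ∃ r : ℕ, ∀ n : ℕ, n % d ≠ r % d → a n = 0

/-- The generating series `C_t` of `231`-avoiding permutations of type `t`,
evaluated at a complex number `z`. -/
noncomputable def Ct (k : ℕ) (t : QT k) (z : ℂ) : ℂ :=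
  ∑' n : ℕ, (cnt k t n : ℂ) * z ^ n

/-- The Catalan generating function. -/
noncomputable def catGF (z : ℂ) : ℂ := ∑' n : ℕ, (catalan n : ℂ) * z ^ n

/-- The entry `M_k(z)_{t,u} = ∂F_t/∂C_u (z; C_v(z), v ∈ 𝒯ₖ)` of the Jacobian matrix of the
type-refined system. -/
noncomputable def Mmat (k : ℕ) (z : ℂ) (t u : QT k) : ℂ :=
  z * ((∑' v : {v : QT k // Realized k v ∧ Hfun k u v = t}, Ct k v.1 z) +
       (∑' v : {v : QT k // Realized k v ∧ Hfun k v u = t}, Ct k v.1 z))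

/-- `lam` is an eigenvalue of the (possibly infinite) matrix `A`, witnessed by a finitely
supported eigenvector. For finite index types this is the usual notion of eigenvalue. -/
def IsEig {α : Type*} (A : α → α → ℂ) (lam : ℂ) : Prop :=
  ∃ v : α →₀ ℂ, v ≠ 0 ∧ ∀ x : α, ∑ y ∈ v.support, A x y * v y = lam * v x


section Game

open FirstOrder.Language

theorem range_pair_snoc {M N : Type} {m : ℕ} (a : Fin m → M) (b : Fin m → N) (x : M) (y : N) :
    (Set.range fun i => ((Fin.snoc a x : Fin (m + 1) → M) i,
      (Fin.snoc b y : Fin (m + 1) → N) i)) =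
      insert (x, y) (Set.range fun i => (a i, b i)) := by
  rw [← Fin.range_snoc]
  congr 1
  funext i
  refine Fin.lastCases ?_ (fun j => ?_) i <;> simp

theorem comp_eq_pair {X : Type} {n : ℕ} (c : Fin n → X) (g : Fin 2 → Fin n) :
    (fun i => c (g i)) = ![c (g 0), c (g 1)] := by
  funext i
  fin_cases i <;> rfl

variable {M N : Type} [L.Structure M] [L.Structure N]

/-- A set of pairs is a partial isomorphism when it respects equality and both orders. -/
def PartialIso (R : Set (M × N)) : Prop :=
  ∀ p ∈ R, ∀ q ∈ R, (p.1 = q.1 ↔ p.2 = q.2) ∧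
    ∀ s : L.Relations 2, Structure.RelMap s ![p.1, q.1] ↔ Structure.RelMap s ![p.2, q.2]

/-- Duplicator wins the Ehrenfeucht–Fraïssé game with `r` remaining rounds
from the position `R`. -/
def Game : ℕ → Set (M × N) → Prop
  | 0, R => PartialIso R
  | r + 1, R => PartialIso R ∧ (∀ x, ∃ y, Game r (insert (x, y) R)) ∧
      (∀ y, ∃ x, Game r (insert (x, y) R))

theorem PartialIso.mono {R R' : Set (M × N)} (h : PartialIso R') (hR : R ⊆ R') :
    PartialIso R :=
  fun p hp q hq => h p (hR hp) q (hR hq)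

theorem Game.partialIso {r : ℕ} {R : Set (M × N)} (h : Game r R) : PartialIso R := by
  cases r with
  | zero => exact h
  | succ r => exact h.1

theorem Game.mono {r : ℕ} {R R' : Set (M × N)} (h : Game r R') (hR : R ⊆ R') : Game r R := by
  induction r generalizing R R' with
  | zero => exact PartialIso.mono h hR
  | succ r ih =>
    refine ⟨h.1.mono hR, fun x => ?_, fun y => ?_⟩
    · obtain ⟨y, hy⟩ := h.2.1 x
      exact ⟨y, ih hy (Set.insert_subset_insert hR)⟩
    · obtain ⟨x, hx⟩ := h.2.2 y
      exact ⟨x, ih hx (Set.insert_subset_insert hR)⟩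

theorem Game.of_succ {r : ℕ} {R : Set (M × N)} (h : Game (r + 1) R) : Game r R := by
  induction r generalizing R with
  | zero => exact h.1
  | succ r ih =>
    refine ⟨h.1, fun x => ?_, fun y => ?_⟩
    · obtain ⟨y, hy⟩ := h.2.1 x
      exact ⟨y, ih hy⟩
    · obtain ⟨x, hx⟩ := h.2.2 y
      exact ⟨x, ih hx⟩

theorem Term.eq_var {m : ℕ} (t : L.Term (Empty ⊕ Fin m)) :
    ∃ i, t = Language.Term.var (Sum.inr i) := by
  cases t with
  | var x =>
    rcases x with x | i
    · exact x.elim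
    · exact ⟨i, rfl⟩
  | func f _ => exact Empty.elim f

theorem Game.realize_iff {m r : ℕ} (φ : L.BoundedFormula Empty m) (hφ : qd φ ≤ r)
    {a : Fin m → M} {b : Fin m → N} (h : Game r (Set.range fun i => (a i, b i)))
    (v : Empty → M) (w : Empty → N) : φ.Realize v a ↔ φ.Realize w b := by
  induction φ generalizing r with
  | falsum => exact Iff.rfl
  | equal t₁ t₂ =>
    obtain ⟨i, rfl⟩ := Term.eq_var t₁
    obtain ⟨j, rfl⟩ := Term.eq_var t₂
    exact (h.partialIso _ ⟨i, rfl⟩ _ ⟨j, rfl⟩).1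
  | rel s ts =>
    choose f hf using fun i => Term.eq_var (ts i)
    obtain rfl : ts = fun i => Language.Term.var (Sum.inr (f i)) := funext hf
    have key := fun (g : Fin 2 → Fin _) => (h.partialIso _ ⟨g 0, rfl⟩ _ ⟨g 1, rfl⟩).2
    change TwoRel _ at s
    cases s with
    | lp =>
      have := key f TwoRel.lp
      simp only [← comp_eq_pair a, ← comp_eq_pair b] at this
      exact this
    | lv =>
      have := key f TwoRel.lv
      simp only [← comp_eq_pair a, ← comp_eq_pair b] at this
      exact this
  | imp f g ihf ihg =>
    simp only [qd, max_le_iff] at hφ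
    exact imp_congr (ihf hφ.1 h) (ihg hφ.2 h)
  | all f ih =>
    simp only [qd] at hφ
    obtain ⟨r, rfl⟩ : ∃ r', r = r' + 1 := ⟨r - 1, by omega⟩
    constructor
    · intro H y
      obtain ⟨x, hx⟩ := h.2.2 y
      rw [← range_pair_snoc] at hx
      exact (ih (by omega) hx).1 (H x)
    · intro H x
      obtain ⟨y, hy⟩ := h.2.1 x
      rw [← range_pair_snoc] at hy
      exact (ih (by omega) hy).2 (H y)

theorem exists_finite_conj {m r : ℕ} {ι : Type} (s : Finset ι)
    (φ : ι → L.BoundedFormula Empty m) (hφ : ∀ i, qd (φ i) ≤ r) :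
    ∃ ψ : L.BoundedFormula Empty m, qd ψ ≤ r ∧
      (∀ (v : Empty → M) (a : Fin m → M), ψ.Realize v a ↔ ∀ i ∈ s, (φ i).Realize v a) ∧
      ∀ (v : Empty → N) (b : Fin m → N), ψ.Realize v b ↔ ∀ i ∈ s, (φ i).Realize v b := by
  classical
  induction s using Finset.induction_on with
  | empty => exact ⟨BoundedFormula.falsum.imp BoundedFormula.falsum, by simp [qd],
      by simp [BoundedFormula.Realize], by simp [BoundedFormula.Realize]⟩
  | insert i s _ ih =>
    obtain ⟨ψ, hψ, h1, h2⟩ := ih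
    refine ⟨((φ i).imp (ψ.imp .falsum)).imp .falsum, ?_, ?_, ?_⟩
    · simp [qd, hψ, hφ i]
    · intro v a
      simp [BoundedFormula.Realize, h1]
    · intro v a
      simp [BoundedFormula.Realize, h2]

theorem exists_extension [Finite N] {m r : ℕ} {a : Fin m → M} {b : Fin m → N}
    {v : Empty → M} {w : Empty → N}
    (h : ∀ φ : L.BoundedFormula Empty m, qd φ ≤ r + 1 → (φ.Realize v a ↔ φ.Realize w b))
    (x : M) : ∃ y, ∀ φ : L.BoundedFormula Empty (m + 1), qd φ ≤ r →
      (φ.Realize v (Fin.snoc a x : Fin (m + 1) → M) ↔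
        φ.Realize w (Fin.snoc b y : Fin (m + 1) → N)) := by
  have := Fintype.ofFinite N
  by_contra! hc
  have hc' : ∀ y, ∃ φ : L.BoundedFormula Empty (m + 1), qd φ ≤ r ∧
      φ.Realize v (Fin.snoc a x : Fin (m + 1) → M) ∧
      ¬ φ.Realize w (Fin.snoc b y : Fin (m + 1) → N) := by
    intro y
    obtain ⟨φ, hφ, hh⟩ := hc y
    rcases hh with hh | hh
    · exact ⟨φ, hφ, hh⟩
    · exact ⟨φ.imp .falsum, by simp [qd, hφ], by simpa [BoundedFormula.Realize] using hh⟩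
  choose φ hφ h1 h2 using hc'
  obtain ⟨ψ, hψ, e1, e2⟩ := exists_finite_conj (M := M) (N := N) Finset.univ φ hφ
  have key := h (ψ.imp .falsum).all (by simp [qd, hψ])
  simp only [BoundedFormula.Realize] at key
  refine key.2 (fun y hy => ?_) x ?_
  · exact h2 y ((e2 _ _).1 hy y (Finset.mem_univ y))
  · exact (e1 _ _).2 fun i _ => h1 i

theorem partialIso_of_realize_iff {m : ℕ} {a : Fin m → M} {b : Fin m → N}
    {v : Empty → M} {w : Empty → N}
    (h : ∀ φ : L.BoundedFormula Empty m, qd φ = 0 → (φ.Realize v a ↔ φ.Realize w b)) :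
    PartialIso (Set.range fun i => (a i, b i)) := by
  rintro _ ⟨i, rfl⟩ _ ⟨j, rfl⟩
  refine ⟨h (.equal (.var (.inr i)) (.var (.inr j))) rfl, fun s => ?_⟩
  have := h (.rel s fun l => .var (.inr (![i, j] l))) rfl
  have ha : (fun l => a (![i, j] l)) = ![a i, a j] := comp_eq_pair a _
  have hb : (fun l => b (![i, j] l)) = ![b i, b j] := comp_eq_pair b _
  rw [← ha, ← hb]
  exact this

theorem Game.of_realize_iff [Finite M] [Finite N] {m r : ℕ} {a : Fin m → M} {b : Fin m → N}
    {v : Empty → M} {w : Empty → N}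
    (h : ∀ φ : L.BoundedFormula Empty m, qd φ ≤ r → (φ.Realize v a ↔ φ.Realize w b)) :
    Game r (Set.range fun i => (a i, b i)) := by
  induction r generalizing m with
  | zero => exact partialIso_of_realize_iff fun φ hφ => h φ hφ.le
  | succ r ih =>
    refine ⟨partialIso_of_realize_iff fun φ hφ => h φ (by omega), fun x => ?_, fun y => ?_⟩
    · obtain ⟨y, hy⟩ := exists_extension h x
      refine ⟨y, ?_⟩
      rw [← range_pair_snoc]
      exact ih hy
    · obtain ⟨x, hx⟩ := exists_extension (fun φ hφ => (h φ hφ).symm) y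
      refine ⟨x, ?_⟩
      rw [← range_pair_snoc]
      exact ih fun φ hφ => (hx φ hφ).symm

end Game

section Counting

/-- The binary tree `T` does not occur as a fringe subtree. -/
def FringeFree (T : BinaryTree Unit) : BinaryTree Unit → Prop
  | .nil => .nil ≠ T
  | .node a l r => .node a l r ≠ T ∧ FringeFree T l ∧ FringeFree T r

theorem FringeFree.ne {T s : BinaryTree Unit} (h : FringeFree T s) : s ≠ T := by
  cases s with
  | nil => exact h
  | node a l r => exact h.1

theorem fringeFree_of_numNodes_lt {T s : BinaryTree Unit} (h : s.numNodes < T.numNodes) :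
    FringeFree T s := by
  induction s with
  | nil => rintro rfl; exact lt_irrefl _ h
  | node a l r ihl ihr =>
    simp only [BinaryTree.numNodes] at h
    refine ⟨?_, ihl (by omega), ihr (by omega)⟩
    rintro rfl
    simp at h

open Classical in
/-- The trees with `n` nodes without fringe subtree `T`. -/
noncomputable def fringeFreeTrees (T : BinaryTree Unit) (n : ℕ) : Finset (BinaryTree Unit) :=
  (BinaryTree.treesOfNumNodesEq n).filter (FringeFree T)

theorem mem_fringeFreeTrees {T s : BinaryTree Unit} {n : ℕ} :
    s ∈ fringeFreeTrees T n ↔ s.numNodes = n ∧ FringeFree T s := by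
  simp [fringeFreeTrees, BinaryTree.mem_treesOfNumNodesEq]

theorem card_fringeFreeTrees_zero (T : BinaryTree Unit) : (fringeFreeTrees T 0).card ≤ 1 := by
  classical
  exact (Finset.card_filter_le _ _).trans (by simp)

theorem card_fringeFreeTrees_succ (T : BinaryTree Unit) (n : ℕ) :
    (fringeFreeTrees T (n + 1)).card + (if n + 1 = T.numNodes then 1 else 0) ≤
      ∑ ij ∈ Finset.HasAntidiagonal.antidiagonal n,
        (fringeFreeTrees T ij.1).card * (fringeFreeTrees T ij.2).card := by
  have hsub : ∀ s ∈ (fringeFreeTrees T (n + 1)) ∪ (if n + 1 = T.numNodes then {T} else ∅),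
      s ∈ (Finset.HasAntidiagonal.antidiagonal n).biUnion fun ij =>
        BinaryTree.pairwiseNode (fringeFreeTrees T ij.1) (fringeFreeTrees T ij.2) := by
    intro s hs
    have hs' : s.numNodes = n + 1 ∧
        ∀ a l r, s = .node a l r → FringeFree T l ∧ FringeFree T r := by
      rcases Finset.mem_union.1 hs with hs | hs
      · obtain ⟨h1, h2⟩ := mem_fringeFreeTrees.1 hs
        exact ⟨h1, by rintro a l r rfl; exact h2.2⟩
      · split_ifs at hs with hn
        · rw [Finset.mem_singleton] at hs
          subst hs
          refine ⟨hn.symm, ?_⟩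
          rintro a l r rfl
          constructor <;> refine fringeFree_of_numNodes_lt ?_ <;>
            simp only [BinaryTree.numNodes] <;> omega
        · simp at hs
    obtain ⟨h1, h2⟩ := hs'
    cases s with
    | nil => simp at h1
    | node a l r =>
      obtain ⟨hl, hr⟩ := h2 a l r rfl
      simp only [BinaryTree.numNodes] at h1
      rw [Finset.mem_biUnion]
      refine ⟨(l.numNodes, r.numNodes), by simp; omega, ?_⟩
      exact Finset.mem_map.2 ⟨(l, r), Finset.mem_product.2
        ⟨mem_fringeFreeTrees.2 ⟨rfl, hl⟩, mem_fringeFreeTrees.2 ⟨rfl, hr⟩⟩, rfl⟩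
  have hdisj : Disjoint (fringeFreeTrees T (n + 1))
      (if n + 1 = T.numNodes then {T} else ∅) := by
    split_ifs
    · rw [Finset.disjoint_singleton_right]
      exact fun h => (mem_fringeFreeTrees.1 h).2.ne rfl
    · simp
  calc _ = ((fringeFreeTrees T (n + 1)) ∪ (if n + 1 = T.numNodes then {T} else ∅)).card := by
        rw [Finset.card_union_of_disjoint hdisj]
        split_ifs <;> simp
    _ ≤ _ := Finset.card_le_card hsub
    _ ≤ _ := Finset.card_biUnion_le
    _ ≤ _ := Finset.sum_le_sum fun ij _ => by
        rw [Finset.card_map, Finset.card_product]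

theorem sum_antidiagonal_le_sq {f : ℕ → ℝ} (hf : ∀ n, 0 ≤ f n) (N : ℕ) :
    ∑ n ∈ Finset.range N, ∑ ij ∈ Finset.HasAntidiagonal.antidiagonal n, f ij.1 * f ij.2 ≤
      (∑ n ∈ Finset.range N, f n) ^ 2 := by
  simp only [Finset.Nat.sum_antidiagonal_eq_sum_range_succ fun i j => f i * f j]
  rw [Finset.sum_range_diag_flip N fun i j => f i * f j, sq, Finset.sum_mul_sum]
  refine Finset.sum_le_sum fun i _ => ?_
  refine Finset.sum_le_sum_of_subset_of_nonneg ?_ fun j _ _ => mul_nonneg (hf i) (hf j)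
  exact Finset.range_subset_range.2 (Nat.sub_le _ _)

theorem sum_range_succ_le {a : ℕ → ℕ} {m : ℕ} (h0 : a 0 ≤ 1)
    (h : ∀ n, a (n + 1) + (if n + 1 = m then 1 else 0) ≤
      ∑ ij ∈ Finset.HasAntidiagonal.antidiagonal n, a ij.1 * a ij.2) {r : ℝ} (hr : 0 ≤ r) (N : ℕ) :
    (∑ n ∈ Finset.range (N + 1), (a n : ℝ) * r ^ n) +
        ∑ n ∈ Finset.range N, (if n + 1 = m then r ^ m else 0) ≤
      1 + r * (∑ n ∈ Finset.range N, (a n : ℝ) * r ^ n) ^ 2 := by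
  have key := sum_antidiagonal_le_sq (f := fun n => (a n : ℝ) * r ^ n)
    (fun n => by positivity) N
  have h0' : (a 0 : ℝ) ≤ 1 := by exact_mod_cast h0
  have hstep : ∀ n, (a (n + 1) : ℝ) * r ^ (n + 1) + (if n + 1 = m then r ^ m else 0) ≤
      r * ∑ ij ∈ Finset.HasAntidiagonal.antidiagonal n, ((a ij.1 : ℝ) * r ^ ij.1) * ((a ij.2 : ℝ) * r ^ ij.2) := by
    intro n
    have hn : ((a (n + 1) : ℝ) + (if n + 1 = m then 1 else 0)) ≤
        ∑ ij ∈ Finset.HasAntidiagonal.antidiagonal n, (a ij.1 : ℝ) * a ij.2 := by exact_mod_cast h n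
    calc _ = ((a (n + 1) : ℝ) + (if n + 1 = m then 1 else 0)) * r ^ (n + 1) := by
          split_ifs with hm
          · rw [hm]; ring
          · ring
      _ ≤ (∑ ij ∈ Finset.HasAntidiagonal.antidiagonal n, (a ij.1 : ℝ) * a ij.2) * r ^ (n + 1) := by gcongr
      _ = _ := by
          rw [Finset.sum_mul, Finset.mul_sum]
          refine Finset.sum_congr rfl fun ij hij => ?_
          rw [← Finset.HasAntidiagonal.mem_antidiagonal.1 hij]
          ring
  rw [Finset.sum_range_succ', add_right_comm, ← Finset.sum_add_distrib]
  have := Finset.sum_le_sum fun n (_ : n ∈ Finset.range N) => hstep n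
  rw [← Finset.mul_sum] at this
  have := mul_le_mul_of_nonneg_left key hr
  simp only [pow_zero, mul_one]
  linarith

theorem sum_range_quarter_lt_two {a : ℕ → ℕ} {m : ℕ} (h0 : a 0 ≤ 1)
    (h : ∀ n, a (n + 1) + (if n + 1 = m then 1 else 0) ≤
      ∑ ij ∈ Finset.HasAntidiagonal.antidiagonal n, a ij.1 * a ij.2) (N : ℕ) :
    ∑ n ∈ Finset.range N, (a n : ℝ) * (1 / 4) ^ n < 2 := by
  induction N with
  | zero => simp
  | succ N ih =>
    have key := sum_range_succ_le h0 h (r := 1 / 4) (by norm_num) N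
    have hpos : 0 ≤ ∑ n ∈ Finset.range N, (if n + 1 = m then (1 / 4 : ℝ) ^ m else 0) :=
      Finset.sum_nonneg fun n _ => by split_ifs <;> positivity
    have hnn : 0 ≤ ∑ n ∈ Finset.range N, (a n : ℝ) * (1 / 4) ^ n :=
      Finset.sum_nonneg fun n _ => by positivity
    nlinarith

theorem exists_summable_of_recursion {a : ℕ → ℕ} {m : ℕ} (hm : 1 ≤ m) (h0 : a 0 ≤ 1)
    (h : ∀ n, a (n + 1) + (if n + 1 = m then 1 else 0) ≤
      ∑ ij ∈ Finset.HasAntidiagonal.antidiagonal n, a ij.1 * a ij.2) :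
    ∃ r : ℝ, 1 / 4 < r ∧ Summable fun n => (a n : ℝ) * r ^ n := by
  have hev : ∀ᶠ r : ℝ in 𝓝 (1 / 4),
      ∑ n ∈ Finset.range m, (a n : ℝ) * r ^ n < 2 ∧ 4 * r - 1 < r ^ m := by
    refine Filter.Eventually.and ?_ ?_
    · refine ContinuousAt.eventually_lt (by fun_prop) continuousAt_const ?_
      exact sum_range_quarter_lt_two h0 h m
    · refine ContinuousAt.eventually_lt (by fun_prop) (by fun_prop) ?_
      norm_num
  obtain ⟨r, ⟨hr1, hr2⟩, hr⟩ :=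
    ((hev.filter_mono nhdsWithin_le_nhds).and (self_mem_nhdsWithin (s := Set.Ioi (1 / 4)))).exists
  have hr : 1 / 4 < r := hr
  refine ⟨r, hr, summable_of_sum_range_le (c := 2) (fun n => by positivity) fun N => ?_⟩
  rcases le_total N m with hN | hN
  · refine le_trans ?_ hr1.le
    exact Finset.sum_le_sum_of_subset_of_nonneg (Finset.range_subset_range.2 hN)
      fun n _ _ => by positivity
  · induction N, hN using Nat.le_induction with
    | base => exact hr1.le
    | succ N hN ih =>
      have key := sum_range_succ_le h0 h (r := r) (by linarith) N
      have hs : r ^ m ≤ ∑ n ∈ Finset.range N, (if n + 1 = m then r ^ m else 0) := by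
        have := Finset.single_le_sum (f := fun n => if n + 1 = m then r ^ m else 0)
          (s := Finset.range N) (fun n _ => by split_ifs <;> positivity)
          (Finset.mem_range.2 (show m - 1 < N by omega))
        simpa [Nat.sub_add_cancel hm] using this
      have hnn : 0 ≤ ∑ n ∈ Finset.range N, (a n : ℝ) * r ^ n :=
        Finset.sum_nonneg fun n _ => by positivity
      have : r * (∑ n ∈ Finset.range N, (a n : ℝ) * r ^ n) ^ 2 ≤ r * 2 ^ 2 := by gcongr
      linarith

end Counting

section Glue

theorem dsum_castAdd {a b : ℕ} (σ : Equiv.Perm (Fin a)) (τ : Equiv.Perm (Fin b)) (i : Fin a) :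
    dsum σ τ (Fin.castAdd b i) = Fin.castAdd b (σ i) := by
  simp [dsum, Equiv.permCongr_apply]

theorem dsum_natAdd {a b : ℕ} (σ : Equiv.Perm (Fin a)) (τ : Equiv.Perm (Fin b)) (j : Fin b) :
    dsum σ τ (Fin.natAdd a j) = Fin.natAdd a (τ j) := by
  simp [dsum, Equiv.permCongr_apply]

theorem val_ssum_castAdd {a b : ℕ} (σ : Equiv.Perm (Fin a)) (τ : Equiv.Perm (Fin b))
    (i : Fin a) : (ssum σ τ (Fin.castAdd b i)).val = b + σ i := by
  simp [ssum, Nat.add_comm]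

theorem val_ssum_natAdd {a b : ℕ} (σ : Equiv.Perm (Fin a)) (τ : Equiv.Perm (Fin b))
    (j : Fin b) : (ssum σ τ (Fin.natAdd a j)).val = τ j := by
  simp [ssum]

/-- The position in `glue p q` of the position `i` of `p`. -/
def posL (p q : FinPerm) (i : Fin p.1) : Fin (glue p q).1 := Fin.castAdd (1 + q.1) i

/-- The position of the maximum of `glue p q`. -/
def posM (p q : FinPerm) : Fin (glue p q).1 := Fin.natAdd p.1 (Fin.castAdd q.1 0)

/-- The position in `glue p q` of the position `j` of `q`. -/
def posR (p q : FinPerm) (j : Fin q.1) : Fin (glue p q).1 := Fin.natAdd p.1 (Fin.natAdd 1 j)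

variable (p q : FinPerm)

@[simp] theorem val_posL (i : Fin p.1) : (posL p q i).val = i := rfl

@[simp] theorem val_posM : (posM p q).val = p.1 := rfl

@[simp] theorem val_posR (j : Fin q.1) : (posR p q j).val = p.1 + (1 + j) := rfl

@[simp] theorem glue_posL (i : Fin p.1) : ((glue p q).2 (posL p q i)).val = p.2 i := by
  exact congrArg Fin.val (dsum_castAdd p.2 (ssum 1 q.2) i)

@[simp] theorem glue_posM : ((glue p q).2 (posM p q)).val = p.1 + q.1 := by
  refine (congrArg Fin.val (dsum_natAdd p.2 (ssum 1 q.2) _)).trans ?_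
  simp [val_ssum_castAdd]

@[simp] theorem glue_posR (j : Fin q.1) :
    ((glue p q).2 (posR p q j)).val = p.1 + q.2 j := by
  refine (congrArg Fin.val (dsum_natAdd p.2 (ssum 1 q.2) _)).trans ?_
  simp [val_ssum_natAdd]

variable {p q}

theorem glue_cases (x : Fin (glue p q).1) :
    (∃ i, x = posL p q i) ∨ x = posM p q ∨ ∃ j, x = posR p q j := by
  refine Fin.addCases (m := p.1) (n := 1 + q.1) (fun i => Or.inl ⟨i, rfl⟩) (fun j => ?_) x
  refine Fin.addCases (m := 1) (n := q.1) (fun i => Or.inr (Or.inl ?_))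
    (fun i => Or.inr (Or.inr ⟨i, rfl⟩)) j
  rw [Subsingleton.elim i 0]
  rfl

theorem avoidsF_glue (hp : AvoidsF p) (hq : AvoidsF q) : AvoidsF (glue p q) := by
  rintro ⟨x, y, z, hxy, hyz, h1, h2⟩
  simp only [Fin.lt_def] at hxy hyz h1 h2
  rcases glue_cases x with ⟨i, rfl⟩ | rfl | ⟨i, rfl⟩ <;>
  rcases glue_cases y with ⟨j, rfl⟩ | rfl | ⟨j, rfl⟩ <;>
  rcases glue_cases z with ⟨l, rfl⟩ | rfl | ⟨l, rfl⟩ <;>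
  simp only [val_posL, val_posM, val_posR, glue_posL, glue_posM, glue_posR] at hxy hyz h1 h2 <;>
  first
    | omega
    | exact hp ⟨i, j, l, hxy, hyz, h1, h2⟩
    | exact hq ⟨i, j, l, by omega, by omega, by omega, by omega⟩

section Decomposition

variable {a b : ℕ} {σ : Equiv.Perm (Fin (a + (1 + b)))}

theorem Avoids.lt_of_lt_of_gt (hσ : Avoids σ) {m : Fin (a + (1 + b))} (hm : ∀ x, σ x ≤ σ m)
    {x y : Fin (a + (1 + b))} (hx : x < m) (hy : m < y) : σ x < σ y := by
  by_contra! h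
  refine hσ ⟨x, m, y, hx, hy, lt_of_le_of_ne h ?_, lt_of_le_of_ne (hm x) ?_⟩
  · exact fun e => (hx.trans hy).ne' (σ.injective e)
  · exact fun e => hx.ne (σ.injective e)

theorem Avoids.val_lt (hσ : Avoids σ) {m : Fin (a + (1 + b))} (hma : m.val = a)
    (hm : ∀ x, σ x ≤ σ m) {x : Fin (a + (1 + b))} (hx : x < m) : (σ x).val < a := by
  by_contra! h
  have hsub : (Finset.Ici m).image σ ⊆ Finset.Ioi (σ x) := by
    intro v hv
    obtain ⟨y, hy, rfl⟩ := Finset.mem_image.1 hv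
    rw [Finset.mem_Ici] at hy
    rw [Finset.mem_Ioi]
    rcases hy.eq_or_lt with rfl | hy
    · exact lt_of_le_of_ne (hm x) fun e => hx.ne (σ.injective e)
    · exact hσ.lt_of_lt_of_gt hm hx hy
  have hcard := Finset.card_le_card hsub
  rw [Finset.card_image_of_injective _ σ.injective, Fin.card_Ici, Fin.card_Ioi] at hcard
  omega

theorem Avoids.le_val (hσ : Avoids σ) {m : Fin (a + (1 + b))} (hma : m.val = a)
    (hm : ∀ x, σ x ≤ σ m) {y : Fin (a + (1 + b))} (hy : m < y) : a ≤ (σ y).val := by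
  have hsub : (Finset.Iio m).image σ ⊆ Finset.Iio (σ y) := by
    intro v hv
    obtain ⟨x, hx, rfl⟩ := Finset.mem_image.1 hv
    rw [Finset.mem_Iio] at hx ⊢
    exact hσ.lt_of_lt_of_gt hm hx hy
  have hcard := Finset.card_le_card hsub
  rw [Finset.card_image_of_injective _ σ.injective, Fin.card_Iio, Fin.card_Iio] at hcard
  omega

theorem Avoids.exists_glue (hσ : Avoids σ) {m : Fin (a + (1 + b))} (hma : m.val = a)
    (hm : ∀ x, σ x ≤ σ m) : ∃ p q : FinPerm, p.1 = a ∧ q.1 = b ∧ AvoidsF p ∧ AvoidsF q ∧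
      glue p q = ⟨a + (1 + b), σ⟩ := by
  have hmax : (σ m).val = a + b := by
    have h := hm (σ.symm ⟨a + b, by omega⟩)
    rw [Equiv.apply_symm_apply, Fin.le_def] at h
    have := (σ m).isLt
    simp only at h
    omega
  let l : Fin a → Fin (a + (1 + b)) := Fin.castAdd (1 + b)
  let r : Fin b → Fin (a + (1 + b)) := fun j => Fin.natAdd a (Fin.natAdd 1 j)
  have hl : ∀ i, (σ (l i)).val < a := fun i =>
    hσ.val_lt hma hm (by rw [Fin.lt_def, hma]; exact i.isLt)
  have hmr : ∀ j, m < r j := fun j => by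
    rw [Fin.lt_def, hma]
    simp only [r, Fin.val_natAdd]
    omega
  have hr : ∀ j, a ≤ (σ (r j)).val := fun j => hσ.le_val hma hm (hmr j)
  have hr' : ∀ j, (σ (r j)).val < a + b := fun j => by
    rw [← hmax, ← Fin.lt_def]
    exact lt_of_le_of_ne (hm _) fun e => (hmr j).ne' (σ.injective e)
  have hinj : Function.Injective fun i : Fin a => (⟨σ (l i), hl i⟩ : Fin a) := by
    intro i j h
    have h' := σ.injective (Fin.ext (Fin.mk.inj_iff.1 h))
    simpa [l] using h'
  have hinj' : Function.Injective fun j : Fin b =>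
      (⟨(σ (r j)).val - a, by have := hr j; have := hr' j; omega⟩ : Fin b) := by
    intro i j h
    have h1 := Fin.mk.inj_iff.1 h
    have h' := σ.injective (Fin.ext (show (σ (r i)).val = (σ (r j)).val by
      have := hr i; have := hr j; omega))
    simpa [r] using h'
  let τ : Equiv.Perm (Fin a) := Equiv.ofBijective _ (Finite.injective_iff_bijective.1 hinj)
  let π : Equiv.Perm (Fin b) := Equiv.ofBijective _ (Finite.injective_iff_bijective.1 hinj')
  have hτ : ∀ i, (τ i).val = σ (l i) := fun i => rfl
  have hπ : ∀ j, a + (π j).val = σ (r j) := fun j => Nat.add_sub_cancel' (hr j)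
  refine ⟨⟨a, τ⟩, ⟨b, π⟩, rfl, rfl, ?_, ?_, ?_⟩
  · rintro ⟨x, y, z, hxy, hyz, h1, h2⟩
    exact hσ ⟨l x, l y, l z, hxy, hyz, h1, h2⟩
  · rintro ⟨x, y, z, hxy, hyz, h1, h2⟩
    simp only [Fin.lt_def] at hxy hyz h1 h2
    refine hσ ⟨r x, r y, r z, ?_, ?_, ?_, ?_⟩ <;> simp only [Fin.lt_def, ← hπ] <;>
      first | omega | (simp only [r, Fin.val_natAdd]; omega)
  · refine Sigma.ext rfl (heq_of_eq (Equiv.ext fun x => Fin.ext ?_))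
    rcases glue_cases (p := ⟨a, τ⟩) (q := ⟨b, π⟩) x with ⟨i, rfl⟩ | rfl | ⟨j, rfl⟩
    · exact glue_posL ⟨a, τ⟩ ⟨b, π⟩ i
    · refine (glue_posM ⟨a, τ⟩ ⟨b, π⟩).trans ?_
      rw [← hmax]
      congr 2
      exact Fin.ext hma
    · exact (glue_posR ⟨a, τ⟩ ⟨b, π⟩ j).trans (hπ j)

end Decomposition

theorem exists_glue_of_avoidsF {s : FinPerm} (hs : AvoidsF s) (h0 : s.1 ≠ 0) :
    ∃ p q : FinPerm, p.1 < s.1 ∧ q.1 < s.1 ∧ AvoidsF p ∧ AvoidsF q ∧ glue p q = s := by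
  obtain ⟨n, σ⟩ := s
  have : NeZero n := ⟨h0⟩
  obtain ⟨m, hm⟩ := Finite.exists_max σ
  obtain ⟨a, b, ha, rfl⟩ : ∃ a b, m.val = a ∧ n = a + (1 + b) :=
    ⟨m.val, n - m.val - 1, rfl, by omega⟩
  obtain ⟨p, q, hp, hq, h1, h2, h3⟩ := Avoids.exists_glue hs ha hm
  exact ⟨p, q, by simp only; omega, by simp only; omega, h1, h2, h3⟩

/-- The permutation encoded by a binary tree. -/
def treePerm : BinaryTree Unit → FinPerm
  | .nil => ⟨0, 1⟩
  | .node _ l r => glue (treePerm l) (treePerm r)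

theorem treePerm_size (T : BinaryTree Unit) : (treePerm T).1 = T.numNodes := by
  induction T with
  | nil => rfl
  | node a l r ihl ihr =>
    simp only [treePerm, glue, BinaryTree.numNodes]
    omega

theorem avoidsF_treePerm (T : BinaryTree Unit) : AvoidsF (treePerm T) := by
  induction T with
  | nil => exact fun ⟨i, _⟩ => i.elim0
  | node a l r ihl ihr => exact avoidsF_glue ihl ihr

theorem exists_treePerm_eq {s : FinPerm} (hs : AvoidsF s) : ∃ T, treePerm T = s := by
  induction hn : s.1 using Nat.strong_induction_on generalizing s with
  | _ n ih =>
    subst hn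
    by_cases h0 : s.1 = 0
    · obtain ⟨n, σ⟩ := s
      simp only at h0
      subst h0
      exact ⟨.nil, Sigma.ext rfl (heq_of_eq (Equiv.ext fun i => i.elim0))⟩
    · obtain ⟨p, q, hp, hq, hpa, hqa, rfl⟩ := exists_glue_of_avoidsF hs h0
      obtain ⟨T₁, rfl⟩ := ih _ hp hpa rfl
      obtain ⟨T₂, rfl⟩ := ih _ hq hqa rfl
      exact ⟨.node () T₁ T₂, rfl⟩

/-- The game on the structures of two permutations. -/
def PGame (k : ℕ) (p p' : FinPerm) (R : Set (Fin p.1 × Fin p'.1)) : Prop :=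
  @Game (Fin p.1) (Fin p'.1) (pStruct p.2) (pStruct p'.2) k R

theorem kEquiv_iff_pGame {k : ℕ} {p p' : FinPerm} : kEquiv k p p' ↔ PGame k p p' ∅ := by
  let _ := pStruct p.2
  let _ := pStruct p'.2
  have hrange : (Set.range fun i : Fin 0 =>
      ((default : Fin 0 → Fin p.1) i, (default : Fin 0 → Fin p'.1) i)) = ∅ :=
    Set.range_eq_empty _
  constructor
  · intro h
    rw [← hrange]
    exact Game.of_realize_iff h
  · intro h ψ hψ
    rw [← hrange] at h
    exact Game.realize_iff ψ hψ h _ _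

/-- The union of positions of the two games played on the parts of `glue`,
with the maxima paired. -/
inductive GluePos {p q p' q' : FinPerm} (R : Set (Fin p.1 × Fin p'.1))
    (Q : Set (Fin q.1 × Fin q'.1)) : Fin (glue p q).1 × Fin (glue p' q').1 → Prop
  | left (x : Fin p.1 × Fin p'.1) (h : x ∈ R) : GluePos R Q (posL p q x.1, posL p' q' x.2)
  | mid : GluePos R Q (posM p q, posM p' q')
  | right (x : Fin q.1 × Fin q'.1) (h : x ∈ Q) : GluePos R Q (posR p q x.1, posR p' q' x.2)

variable {p' q' : FinPerm}

theorem partialIso_iff {R : Set (Fin p.1 × Fin p'.1)} :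
    @PartialIso (Fin p.1) (Fin p'.1) (pStruct p.2) (pStruct p'.2) R ↔
      ∀ x ∈ R, ∀ y ∈ R, (x.1.val = y.1.val ↔ x.2.val = y.2.val) ∧
        (x.1.val < y.1.val ↔ x.2.val < y.2.val) ∧
        ((p.2 x.1).val < (p.2 y.1).val ↔ (p'.2 x.2).val < (p'.2 y.2).val) := by
  simp only [← Fin.ext_iff, ← Fin.lt_def]
  refine forall₂_congr fun x _ => forall₂_congr fun y _ => and_congr_right fun _ => ?_
  constructor
  · exact fun h => ⟨h TwoRel.lp, h TwoRel.lv⟩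
  · intro h s
    change TwoRel 2 at s
    cases s with
    | lp => exact h.1
    | lv => exact h.2

theorem partialIso_gluePos {R : Set (Fin p.1 × Fin p'.1)} {Q : Set (Fin q.1 × Fin q'.1)}
    (hR : @PartialIso (Fin p.1) (Fin p'.1) (pStruct p.2) (pStruct p'.2) R)
    (hQ : @PartialIso (Fin q.1) (Fin q'.1) (pStruct q.2) (pStruct q'.2) Q) :
    @PartialIso _ _ (pStruct (glue p q).2) (pStruct (glue p' q').2) {x | GluePos R Q x} := by
  rw [partialIso_iff] at *
  intro x hx y hy
  rcases hx with ⟨x, hx⟩ | _ | ⟨x, hx⟩ <;> rcases hy with ⟨y, hy⟩ | _ | ⟨y, hy⟩ <;>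
    simp only [val_posL, val_posM, val_posR, glue_posL, glue_posM, glue_posR] <;>
    first
      | omega
      | (have := hR x hx y hy; omega)
      | (have := hQ x hx y hy; omega)
      | simp only [lt_self_iff_false, and_self]

theorem pGame_glue {k : ℕ} {R : Set (Fin p.1 × Fin p'.1)} {Q : Set (Fin q.1 × Fin q'.1)}
    (hR : PGame k p p' R) (hQ : PGame k q q' Q) :
    PGame k (glue p q) (glue p' q') {x | GluePos R Q x} := by
  let _ := pStruct p.2
  let _ := pStruct p'.2
  let _ := pStruct q.2
  let _ := pStruct q'.2
  let _ := pStruct (glue p q).2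
  let _ := pStruct (glue p' q').2
  induction k generalizing R Q with
  | zero => exact partialIso_gluePos hR hQ
  | succ k ih =>
    have hR' : PGame k p p' R := Game.of_succ hR
    have hQ' : PGame k q q' Q := Game.of_succ hQ
    have left : ∀ {x y}, PGame k p p' (insert (x, y) R) →
        PGame k (glue p q) (glue p' q')
          (insert (posL p q x, posL p' q' y) {x | GluePos R Q x}) := by
      intro x y h
      refine Game.mono (ih h hQ') (Set.insert_subset_iff.2 ⟨?_, fun z hz => ?_⟩)
      · exact GluePos.left (x, y) (Set.mem_insert _ _)
      · rcases hz with ⟨z, hz⟩ | _ | ⟨z, hz⟩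
        · exact GluePos.left z (Set.mem_insert_of_mem _ hz)
        · exact GluePos.mid
        · exact GluePos.right z hz
    have mid : PGame k (glue p q) (glue p' q')
        (insert (posM p q, posM p' q') {x | GluePos R Q x}) := by
      rw [Set.insert_eq_of_mem (show (posM p q, posM p' q') ∈ {x | GluePos R Q x} from .mid)]
      exact ih hR' hQ'
    have right : ∀ {x y}, PGame k q q' (insert (x, y) Q) →
        PGame k (glue p q) (glue p' q')
          (insert (posR p q x, posR p' q' y) {x | GluePos R Q x}) := by
      intro x y h
      refine Game.mono (ih hR' h) (Set.insert_subset_iff.2 ⟨?_, fun z hz => ?_⟩)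
      · exact GluePos.right (x, y) (Set.mem_insert _ _)
      · rcases hz with ⟨z, hz⟩ | _ | ⟨z, hz⟩
        · exact GluePos.left z hz
        · exact GluePos.mid
        · exact GluePos.right z (Set.mem_insert_of_mem _ hz)
    refine ⟨partialIso_gluePos (Game.partialIso hR) (Game.partialIso hQ),
      fun x => ?_, fun y => ?_⟩
    · rcases glue_cases x with ⟨i, rfl⟩ | rfl | ⟨j, rfl⟩
      · obtain ⟨y, hy⟩ := hR.2.1 i
        exact ⟨_, left hy⟩
      · exact ⟨_, mid⟩
      · obtain ⟨y, hy⟩ := hQ.2.1 j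
        exact ⟨_, right hy⟩
    · rcases glue_cases y with ⟨i, rfl⟩ | rfl | ⟨j, rfl⟩
      · obtain ⟨x, hx⟩ := hR.2.2 i
        exact ⟨_, left hx⟩
      · exact ⟨_, mid⟩
      · obtain ⟨x, hx⟩ := hQ.2.2 j
        exact ⟨_, right hx⟩

theorem kEquiv_glue {k : ℕ} (hp : kEquiv k p p') (hq : kEquiv k q q') :
    kEquiv k (glue p q) (glue p' q') := by
  let _ := pStruct (glue p q).2
  let _ := pStruct (glue p' q').2
  rw [kEquiv_iff_pGame] at *
  exact Game.mono (pGame_glue hp hq) (Set.empty_subset _)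

theorem Hfun_typeOf (k : ℕ) (p q : FinPerm) :
    Hfun k (typeOf k p) (typeOf k q) = typeOf k (glue p q) :=
  Quotient.sound (s := kSetoid k)
    (kEquiv_glue (Quotient.mk_out (s := kSetoid k) p) (Quotient.mk_out (s := kSetoid k) q))

end Glue

/-- The realized type of the permutation encoded by a binary tree. -/
def treeType (k : ℕ) (T : BinaryTree Unit) : Tk k :=
  ⟨typeOf k (treePerm T), treePerm T, avoidsF_treePerm T, rfl⟩

theorem treeType_mem_of_not_fringeFree {k : ℕ} {S : Set (Tk k)}
    (hS : ∀ u ∈ S, ∀ v : Tk k, EdgeT k u v → v ∈ S) {T₀ T : BinaryTree Unit}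
    (h₀ : treeType k T₀ ∈ S) (hT : ¬ FringeFree T₀ T) : treeType k T ∈ S := by
  induction T with
  | nil =>
    rw [FringeFree, not_not] at hT
    rwa [hT]
  | node a l r ihl ihr =>
    by_cases he : BinaryTree.node a l r = T₀
    · rwa [he]
    by_cases hl : FringeFree T₀ l
    · have hr : ¬ FringeFree T₀ r := fun hr => hT ⟨he, hl, hr⟩
      exact hS _ (ihr hr) _ ⟨_, (treeType k l).2, Or.inr (Hfun_typeOf k _ _)⟩
    · exact hS _ (ihl hl) _ ⟨_, (treeType k r).2, Or.inl (Hfun_typeOf k _ _)⟩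

theorem cnt_le_card_fringeFreeTrees {k : ℕ} {S : Set (Tk k)}
    (hS : ∀ u ∈ S, ∀ v : Tk k, EdgeT k u v → v ∈ S) {T₀ : BinaryTree Unit}
    (h₀ : treeType k T₀ ∈ S) {t : Tk k} (ht : t ∉ S) (n : ℕ) :
    cnt k t.1 n ≤ (fringeFreeTrees T₀ n).card := by
  have hex : ∀ σ : {σ : Equiv.Perm (Fin n) // Avoids σ ∧ typeOf k ⟨n, σ⟩ = t.1},
      ∃ T : fringeFreeTrees T₀ n, treePerm T.1 = ⟨n, σ.1⟩ := by
    rintro ⟨σ, hσ, hσt⟩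
    obtain ⟨T, hT⟩ := exists_treePerm_eq (s := ⟨n, σ⟩) hσ
    refine ⟨⟨T, mem_fringeFreeTrees.2 ⟨by rw [← treePerm_size, hT], ?_⟩⟩, hT⟩
    by_contra hf
    refine ht ?_
    convert treeType_mem_of_not_fringeFree hS h₀ hf
    refine Subtype.ext ?_
    simp only [treeType, hT, hσt]
  choose f hf using hex
  have hinj : Function.Injective f := by
    intro σ τ h
    have := (hf σ).symm.trans ((congrArg (fun T => treePerm T.1) h).trans (hf τ))
    exact Subtype.ext (eq_of_heq (Sigma.mk.inj_iff.1 this).2)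
  rw [cnt, ← Nat.card_eq_finsetCard]
  exact Nat.card_le_card_of_injective f hinj

theorem exists_summable_cnt {k : ℕ} {S : Set (Tk k)} (hS : IsTermSCC k S) {t : Tk k}
    (ht : t ∉ S) : ∃ r : ℝ, 1 / 4 < r ∧ Summable fun n : ℕ => (cnt k t.1 n : ℝ) * r ^ n := by
  obtain ⟨⟨⟨_, s, hs, rfl⟩, hu⟩, -, hclosed⟩ := hS
  obtain ⟨T₀, rfl⟩ := exists_treePerm_eq hs
  have hle := cnt_le_card_fringeFreeTrees hclosed (T₀ := T₀) hu ht
  obtain ⟨r, hr, hsum⟩ : ∃ r : ℝ, 1 / 4 < r ∧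
      Summable fun n => ((fringeFreeTrees T₀ n).card : ℝ) * r ^ n := by
    rcases Nat.eq_zero_or_pos T₀.numNodes with h0 | h0
    · refine ⟨1, by norm_num, ?_⟩
      have hempty : ∀ s, ¬ FringeFree T₀ s := by
        cases T₀ with
        | node a l r => simp at h0
        | nil =>
          intro s
          induction s with
          | nil => exact fun h => h rfl
          | node a l r ihl _ => exact fun h => ihl h.2.1
      have hcard : ∀ n, (fringeFreeTrees T₀ n).card = 0 := fun n =>
        Finset.card_eq_zero.2 (Finset.eq_empty_of_forall_notMem fun s hs =>
          hempty s (mem_fringeFreeTrees.1 hs).2)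
      simp [hcard, summable_zero]
    · exact exists_summable_of_recursion h0 (card_fringeFreeTrees_zero T₀)
        (card_fringeFreeTrees_succ T₀)
  refine ⟨r, hr, Summable.of_nonneg_of_le (fun n => by positivity) (fun n => ?_) hsum⟩
  have : (cnt k t.1 n : ℝ) ≤ (fringeFreeTrees T₀ n).card := by exact_mod_cast hle n
  gcongr

theorem isBigO_inv_pow_of_summable {a : ℕ → ℝ} {r : ℝ} (hr : 0 < r)
    (h : Summable fun n => a n * r ^ n) : a =O[atTop] fun n => r⁻¹ ^ n := by
  have h1 : (fun n => a n * r ^ n) =O[atTop] fun _ => (1 : ℝ) :=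
    h.tendsto_atTop_zero.isBigO_one ℝ
  have h2 := h1.mul (isBigO_refl (fun n : ℕ => r⁻¹ ^ n) atTop)
  refine h2.congr (fun n => ?_) fun n => one_mul _
  rw [mul_assoc, ← mul_pow, mul_inv_cancel₀ hr.ne', one_pow, mul_one]

/-- For every type `t` outside the terminal strongly connected component, the series `C_t`
has radius of convergence strictly larger than `1/4`; consequently its coefficients are
`O(κ^n)` for some `κ < 4`. -/
theorem subcritical_types (k : ℕ) (hk : 2 ≤ k) (S : Set (Tk k)) (hS : IsTermSCC k S)
    (t : Tk k) (ht : t ∉ S) :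
    (∃ r : ℝ, 1 / 4 < r ∧ Summable fun n : ℕ => (cnt k t.1 n : ℝ) * r ^ n) ∧
    (∃ κ : ℝ, 0 ≤ κ ∧ κ < 4 ∧
      (fun n : ℕ => (cnt k t.1 n : ℝ)) =O[atTop] fun n : ℕ => κ ^ n) := by
  obtain ⟨r, hr, hsum⟩ := exists_summable_cnt hS ht
  refine ⟨⟨r, hr, hsum⟩, r⁻¹, by positivity, ?_, isBigO_inv_pow_of_summable (by linarith) hsum⟩
  rw [inv_lt_comm₀ (by linarith) (by norm_num)]
  linarith

end Av231
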